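/- Let G be a connected balanced grid graph on a finite set V ⊆ ℤ², and let B be the bounding box of V. Let H′ be the graph on vertex set B whose edges are all pairs of distinct odd vertices of B together with all pairs of vertices of B at L¹-distance 1 (so H′ is a split graph: the odd vertices form a clique and the even vertices form an independent set). Define colorings f, f′ of H′ by: f(x, y) = 1 if x + y is odd and f(x, y) = 2 if x + y is even; f′(v) = 3 − f(v) for v ∈ V and f′(v) = f(v) for v ∈ B ∖ V. Then G has a Hamiltonian path if and only if there is a walk in H′ of length at most |V| − 1 that transforms f into f′. -/

import Mathlib

/-- Swap the colors of vertices `a` and `b`. -/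
def swapC {V C : Type*} [DecidableEq V] (f : V → C) (a b : V) : V → C :=
  fun v => if v = a then f b else if v = b then f a else f v

/-- The coloring obtained from `f` by sequentially swapping the colors of
consecutive vertices along the list (walk) of vertices. -/
def transformList {V C : Type*} [DecidableEq V] : List V → (V → C) → (V → C)
  | [], f => f
  | [_], f => f
  | a :: b :: rest, f => transformList (b :: rest) (swapC f a b)

/-- Grid adjacency on `ℤ²`: two points are adjacent iff their L¹-distance
is `1`. -/
def gridAdj (a b : ℤ × ℤ) : Prop := |a.1 - b.1| + |a.2 - b.2| = 1

instance : ∀ a b, Decidable (gridAdj a b) := fun a b => by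
  unfold gridAdj; infer_instance

/-- Split adjacency on `ℤ²`: two distinct odd points are always adjacent
(the odd points form a clique), and two points at L¹-distance `1` are
adjacent; even points form an independent set among themselves except for
grid edges. -/
def splitAdj (a b : ℤ × ℤ) : Prop :=
  (a ≠ b ∧ (a.1 + a.2) % 2 ≠ 0 ∧ (b.1 + b.2) % 2 ≠ 0) ∨ gridAdj a b

/-- A point `(x, y)` of `ℤ²` is even if `x + y` is even. -/
def evenPt (p : ℤ × ℤ) : Prop := (p.1 + p.2) % 2 = 0

instance : ∀ p, Decidable (evenPt p) := fun p => by
  unfold evenPt; infer_instance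

/-- A finite set of grid points is balanced if it has equally many even and
odd points. -/
def BalancedPts (V : Finset (ℤ × ℤ)) : Prop :=
  (V.filter (fun p => evenPt p)).card = (V.filter (fun p => ¬ evenPt p)).card

/-- The graph with vertex set `S` and adjacency `A` is connected: any two
vertices of `S` are joined by a walk staying inside `S`. -/
def ConnOn (S : Set (ℤ × ℤ)) (A : ℤ × ℤ → ℤ × ℤ → Prop) : Prop :=
  ∀ a ∈ S, ∀ b ∈ S, ∃ l : List (ℤ × ℤ), (∀ x ∈ l, x ∈ S) ∧ l.Chain' A ∧
    l.head? = some a ∧ l.getLast? = some b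

/-- The grid graph on `S` has a Hamiltonian path. -/
def HamPathOn (S : Finset (ℤ × ℤ)) : Prop :=
  ∃ l : List (ℤ × ℤ), l.Chain' gridAdj ∧ l.Nodup ∧ ∀ x, x ∈ l ↔ x ∈ S

theorem swapC_left {V C : Type*} [DecidableEq V] (f : V → C) (a b : V) :
    swapC f a b a = f b := by
  simp [swapC]

theorem swapC_of_ne {V C : Type*} [DecidableEq V] (f : V → C) {a b v : V}
    (ha : v ≠ a) (hb : v ≠ b) : swapC f a b v = f v := by
  simp [swapC, ha, hb]

theorem swapC_right {V C : Type*} [DecidableEq V] (f : V → C) {a b : V} (h : b ≠ a) :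
    swapC f a b b = f a := by
  simp [swapC, h]

/-- A walk leaves the color of every vertex it does not visit unchanged. -/
theorem transformList_of_notMem {V C : Type*} [DecidableEq V] {v : V} :
    ∀ (l : List V) (f : V → C), v ∉ l → transformList l f v = f v
  | [], _, _ => rfl
  | [_], _, _ => rfl
  | a :: b :: r, f, h => by
    rw [transformList, transformList_of_notMem (b :: r) _ (by simp_all)]
    exact swapC_of_ne f (by simp_all) (by simp_all)

/-- The first vertex of a simple walk receives the color of the second one. -/
theorem transformList_cons_cons_self {V C : Type*} [DecidableEq V] {a b : V} {r : List V}
    (f : V → C) (h : (a :: b :: r).Nodup) : transformList (a :: b :: r) f a = f b := by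
  rw [transformList, transformList_of_notMem _ _ (List.nodup_cons.1 h).1, swapC_left]

/-- Swapping the first two vertices of a simple walk does not affect the later ones. -/
theorem swapC_eq_of_mem_tail {V C : Type*} [DecidableEq V] {a b : V} {r : List V} {f g : V → C}
    (h : (a :: b :: r).Nodup) (hg : ∀ v ∈ b :: r, g v = f v) :
    ∀ v ∈ r, swapC g a b v = f v := by
  intro v hv
  simp only [List.nodup_cons, List.mem_cons, not_or] at h
  rw [swapC_of_ne g (by rintro rfl; exact h.1.2 hv) (by rintro rfl; exact h.2.1 hv)]
  exact hg v (List.mem_cons_of_mem _ hv)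

/-- The coloring of `ℤ²` by parity: odd points get `1`, even points get `2`. -/
def parityColor (p : ℤ × ℤ) : ℕ := if evenPt p then 2 else 1

theorem parityColor_eq_one_or_two (p : ℤ × ℤ) : parityColor p = 1 ∨ parityColor p = 2 := by
  unfold parityColor; split_ifs <;> simp

theorem parityColor_add_of_gridAdj {a b : ℤ × ℤ} (h : gridAdj a b) :
    parityColor a + parityColor b = 3 := by
  unfold gridAdj at h
  have hodd : (a.1 + a.2 + (b.1 + b.2)) % 2 = 1 := by
    rcases abs_cases (a.1 - b.1) with h₁ | h₁ <;>
      rcases abs_cases (a.2 - b.2) with h₂ | h₂ <;> omega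
  by_cases ha : evenPt a <;> by_cases hb : evenPt b <;> simp only [parityColor, ha, hb] <;>
    unfold evenPt at ha hb <;> first | rfl | omega

theorem gridAdj_of_splitAdj {a b : ℤ × ℤ} (h : splitAdj a b)
    (hc : parityColor b ≠ parityColor a) : gridAdj a b := by
  rcases h with ⟨-, ha, hb⟩ | h
  · simp [parityColor, evenPt, ha, hb] at hc
  · exact h

/-- A simple grid walk flips the parity color of each of its vertices except the last one,
which receives the color of the first vertex. -/
theorem transformList_of_isChain_gridAdj (l : List (ℤ × ℤ)) :
    ∀ (a : ℤ × ℤ) (g : ℤ × ℤ → ℕ), (a :: l).Nodup → (a :: l).IsChain gridAdj →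
      (∀ v ∈ l, g v = parityColor v) → ∀ v ∈ a :: l,
        transformList (a :: l) g v =
          if v = (a :: l).getLast (List.cons_ne_nil a l) then g a else 3 - parityColor v := by
  induction l with
  | nil => intro a g _ _ _ v hv; simp_all [transformList]
  | cons b r ih =>
    intro a g hn hc hg v hv
    have hn' := List.nodup_cons.1 hn
    have hab := parityColor_add_of_gridAdj (List.isChain_cons_cons.1 hc).1
    rw [List.getLast_cons (List.cons_ne_nil b r)]
    rcases List.mem_cons.1 hv with rfl | hv
    · rw [transformList_cons_cons_self g hn, if_neg, hg b (by simp)]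
      · omega
      · intro h
        exact hn'.1 (h ▸ List.getLast_mem _)
    · rw [transformList, ih b _ hn'.2 (List.isChain_cons_cons.1 hc).2
        (swapC_eq_of_mem_tail hn hg) v hv, swapC_right g (by rintro rfl; simp at hn')]

/-- If a simple walk in the split graph changes the parity color of all its vertices,
then it only uses grid edges. -/
theorem isChain_gridAdj_of_transformList_ne (l : List (ℤ × ℤ)) :
    ∀ (a : ℤ × ℤ) (g : ℤ × ℤ → ℕ), (a :: l).Nodup → (a :: l).IsChain splitAdj →
      (∀ v ∈ l, g v = parityColor v) →
      (∀ v ∈ a :: l, transformList (a :: l) g v ≠ parityColor v) →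
      (a :: l).IsChain gridAdj := by
  induction l with
  | nil => simp
  | cons b r ih =>
    intro a g hn hc hg ht
    have hta := ht a (by simp)
    rw [transformList_cons_cons_self g hn, hg b (by simp)] at hta
    rw [List.isChain_cons_cons] at hc ⊢
    exact ⟨gridAdj_of_splitAdj hc.1 hta, ih b _ (List.nodup_cons.1 hn).2 hc.2
      (swapC_eq_of_mem_tail hn hg) fun v hv => ht v (List.mem_cons_of_mem _ hv)⟩

/-- Colors alternate along a grid walk, so their deviations from the mean `3 / 2` telescope. -/
theorem sum_parityColor_of_isChain_gridAdj (l : List (ℤ × ℤ)) :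
    ∀ a : ℤ × ℤ, (a :: l).IsChain gridAdj →
      2 * ((a :: l).map fun v => 2 * (parityColor v : ℤ) - 3).sum =
        (2 * (parityColor a : ℤ) - 3) +
          (2 * (parityColor ((a :: l).getLast (List.cons_ne_nil a l)) : ℤ) - 3) := by
  induction l with
  | nil => intro a _; simp; ring
  | cons b r ih =>
    intro a hc
    have hab := parityColor_add_of_gridAdj (List.isChain_cons_cons.1 hc).1
    rw [List.getLast_cons (List.cons_ne_nil b r), List.map_cons, List.sum_cons, mul_add,
      ih b (List.isChain_cons_cons.1 hc).2]
    omega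

theorem BalancedPts.sum_parityColor {V : Finset (ℤ × ℤ)} (h : BalancedPts V) :
    ∑ v ∈ V, (2 * (parityColor v : ℤ) - 3) = 0 := by
  rw [← Finset.sum_filter_add_sum_filter_not V evenPt,
    Finset.sum_congr rfl (g := fun _ => (1 : ℤ)),
    Finset.sum_congr (s₁ := V.filter fun p => ¬ evenPt p) rfl (g := fun _ => (-1 : ℤ))]
  · unfold BalancedPts at h
    simp [h]
  · intro v hv
    simp [parityColor, (Finset.mem_filter.1 hv).2]
  · intro v hv
    simp [parityColor, (Finset.mem_filter.1 hv).2]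

theorem mem_boundingBox {V : Finset (ℤ × ℤ)} (hne : V.Nonempty) {v : ℤ × ℤ} (hv : v ∈ V) :
    v ∈ (Finset.Icc ((V.image Prod.fst).min' (hne.image _))
          ((V.image Prod.fst).max' (hne.image _))) ×ˢ
        (Finset.Icc ((V.image Prod.snd).min' (hne.image _))
          ((V.image Prod.snd).max' (hne.image _))) := by
  have h₁ := Finset.mem_image_of_mem Prod.fst hv
  have h₂ := Finset.mem_image_of_mem Prod.snd hv
  simp only [Finset.mem_product, Finset.mem_Icc]
  exact ⟨⟨Finset.min'_le _ _ h₁, Finset.le_max' _ _ h₁⟩,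
    ⟨Finset.min'_le _ _ h₂, Finset.le_max' _ _ h₂⟩⟩


/-- let `G` be a connected balanced grid graph on a finite
`V ⊆ ℤ²`, `B` the bounding box of `V`, and `H'` the split graph on `B` whose
edges are all pairs of distinct odd points of `B` together with all grid
edges of `B`. With `f` coloring odd points `1` and even points `2`, and `f'`
flipping `f` exactly on `V`, the graph `G` has a Hamiltonian path iff there
is a walk in `H'` of length at most `|V| - 1` transforming `f` into `f'`. -/
theorem ham_path_iff_swap_walk_split (V : Finset (ℤ × ℤ)) (hne : V.Nonempty)
    (hconn : ConnOn (↑V) gridAdj) (hbal : BalancedPts V) :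
    let B : Finset (ℤ × ℤ) :=
      (Finset.Icc ((V.image Prod.fst).min' (hne.image _))
          ((V.image Prod.fst).max' (hne.image _))) ×ˢ
        (Finset.Icc ((V.image Prod.snd).min' (hne.image _))
          ((V.image Prod.snd).max' (hne.image _)))
    let f : ℤ × ℤ → ℕ := fun p => if evenPt p then 2 else 1
    let f' : ℤ × ℤ → ℕ := fun p => if p ∈ V then 3 - f p else f p
    HamPathOn V ↔
      ∃ m : List (ℤ × ℤ), (∀ x ∈ m, x ∈ B) ∧ m.Chain' splitAdj ∧ m ≠ [] ∧
        transformList m f = f' ∧ m.length - 1 ≤ V.card - 1 := by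
  intro B f f'
  have hf : f = parityColor := rfl
  have hflip : ∀ v ∈ V, f' v = 3 - parityColor v := fun v hv => if_pos hv
  have hfix : ∀ v ∉ V, f' v = parityColor v := fun v hv => if_neg hv
  have hpos := hne.card_pos
  constructor
  · rintro ⟨l, hc, hn, hl⟩
    have hlV : l.toFinset = V := by ext v; simp [hl]
    cases l with
    | nil => simp [← hlV] at hne
    | cons a r =>
      refine ⟨a :: r, fun v hv => mem_boundingBox hne ((hl v).1 hv),
        hc.imp fun _ _ h => Or.inr h, List.cons_ne_nil a r, ?_, ?_⟩
      · have hsum := sum_parityColor_of_isChain_gridAdj r a hc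
        rw [← List.sum_toFinset _ hn, hlV, hbal.sum_parityColor] at hsum
        funext v
        by_cases hv : v ∈ V
        · rw [hflip v hv, hf, transformList_of_isChain_gridAdj r a _ hn hc (fun _ _ => rfl) v
            ((hl v).2 hv)]
          split_ifs with h
          · rw [← h] at hsum
            omega
          · rfl
        · rw [hfix v hv, transformList_of_notMem _ _ fun h => hv ((hl v).1 h), hf]
      · rw [← hlV, List.toFinset_card_of_nodup hn]
  · rintro ⟨m, -, hc, hm, ht, hlen⟩
    have hchange : ∀ v ∈ V, transformList m parityColor v ≠ parityColor v := by
      intro v hv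
      rw [← hf, ht, hflip v hv, hf]
      rcases parityColor_eq_one_or_two v with h | h <;> simp [h]
    have hsub : V ⊆ m.toFinset := fun v hv => by
      by_contra h
      exact hchange v hv (transformList_of_notMem _ _ (by simpa using h))
    have hmV : V = m.toFinset := Finset.eq_of_subset_of_card_le hsub
      (m.toFinset_card_le.trans (by omega))
    have hn : m.Nodup := by
      rw [← Multiset.coe_nodup, ← Multiset.toFinset_card_eq_card_iff_nodup]
      refine le_antisymm (Multiset.toFinset_card_le _) ?_
      change m.length ≤ m.toFinset.card
      rw [← hmV]
      omega
    refine ⟨m, ?_, hn, fun v => by simp [hmV]⟩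
    cases m with
    | nil => exact absurd rfl hm
    | cons a r =>
      exact isChain_gridAdj_of_transformList_ne r a _ hn hc (fun _ _ => rfl)
        fun v hv => hchange v (by simpa [hmV] using hv)
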